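/- (Π₂ case of cut-free primitive recursive completeness.) Every true Π₂ sentence has a primitive recursive cut-free ω-proof encodable in C_prec^-: if ∀x∃y A(x,y) is a sentence with A(x,y) quantifier-free and ∀x∃y A(x,y) is true in ℕ, then there exists a ∈ C_prec^- with End(a) = {∀x∃y A(x,y)} such that π(a) is a primitive recursive cut-free ω-proof. -/

import Mathlib

namespace Shoen

/-- Kleene application: value of the `e`-th partial recursive function at `n`,
in the standard numbering via `Nat.Partrec.Code`. -/
def peval (e n : ℕ) : Part ℕ := (Denumerable.ofNat Nat.Partrec.Code e).eval n

/-- `e` is an index of a (total) primitive recursive function. -/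
def PrimIndex (e : ℕ) : Prop := ∃ f : ℕ → ℕ, Nat.Primrec f ∧ ∀ n, peval e n = Part.some (f n)

/-- Kleene's relation `<_O`. -/
inductive KLt : ℕ → ℕ → Prop
  | base : KLt 1 2
  | step {a b : ℕ} : KLt a b → KLt b (2 ^ b)
  | lim {e : ℕ} (h : ∀ n, (peval e n).Dom)
      (hm : ∀ n, KLt ((peval e n).get (h n)) ((peval e (n + 1)).get (h (n + 1))))
      (n : ℕ) : KLt ((peval e n).get (h n)) (3 * 5 ^ e)
  | trans {a b c : ℕ} : KLt a b → KLt b c → KLt a c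

/-- Kleene's `O`. -/
def KO (a : ℕ) : Prop := KLt a (2 ^ a)

/-- The auxiliary relation `<'_O`. -/
inductive KLt' : ℕ → ℕ → Prop
  | base : KLt' 1 2
  | step {a b : ℕ} : KLt' a b → KLt' b (2 ^ b)
  | lim {e n x : ℕ} : x ∈ peval e n → KLt' x (3 * 5 ^ e)
  | trans {a b c : ℕ} : KLt' a b → KLt' b c → KLt' a c

/-- The inductive characterization `O'` of Kleene's `O`. -/
inductive KO' : ℕ → Prop
  | one : KO' 1
  | step {a : ℕ} : KO' a → KO' (2 ^ a)
  | lim {e : ℕ} (h : ∀ n, (peval e n).Dom)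
      (hm : ∀ n, KLt' ((peval e n).get (h n)) ((peval e (n + 1)).get (h (n + 1)))) :
      KO' (3 * 5 ^ e)



/-! ### Syntax of first order arithmetic (negation normal form) -/

/-- Terms of the language `0,1,+,×,=`, with de Bruijn variables. -/
inductive Trm : Type
  | var : ℕ → Trm
  | zero : Trm
  | one : Trm
  | add : Trm → Trm → Trm
  | mul : Trm → Trm → Trm
deriving DecidableEq

/-- Formulas in negation normal form: literals (atomic and negated atomic
formulas) combined by `∧, ∨, ∀, ∃` (de Bruijn binders). -/
inductive Fml : Type
  | eq : Trm → Trm → Fml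
  | ne : Trm → Trm → Fml
  | and : Fml → Fml → Fml
  | or : Fml → Fml → Fml
  | all : Fml → Fml
  | ex : Fml → Fml
deriving DecidableEq

/-- All free variables of a term are `< k`. -/
def Trm.cu : Trm → ℕ → Bool
  | .var i, k => decide (i < k)
  | .zero, _ => true
  | .one, _ => true
  | .add s t, k => s.cu k && t.cu k
  | .mul s t, k => s.cu k && t.cu k

/-- All free variables of a formula are `< k`. -/
def Fml.cu : Fml → ℕ → Bool
  | .eq s t, k => s.cu k && t.cu k
  | .ne s t, k => s.cu k && t.cu k
  | .and A B, k => A.cu k && B.cu k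
  | .or A B, k => A.cu k && B.cu k
  | .all A, k => A.cu (k + 1)
  | .ex A, k => A.cu (k + 1)

/-- A sentence is a closed formula. -/
abbrev Sentence : Type := { A : Fml // A.cu 0 = true }

/-- Value of a term under an environment. -/
def Trm.val (ρ : ℕ → ℕ) : Trm → ℕ
  | .var i => ρ i
  | .zero => 0
  | .one => 1
  | .add s t => s.val ρ + t.val ρ
  | .mul s t => s.val ρ * t.val ρ

/-- Extend an environment by a value for variable `0`. -/
def consEnv (n : ℕ) (ρ : ℕ → ℕ) : ℕ → ℕ
  | 0 => n
  | k + 1 => ρ k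

/-- Satisfaction in the standard model `ℕ`. -/
def Fml.Sat (ρ : ℕ → ℕ) : Fml → Prop
  | .eq s t => s.val ρ = t.val ρ
  | .ne s t => s.val ρ ≠ t.val ρ
  | .and A B => A.Sat ρ ∧ B.Sat ρ
  | .or A B => A.Sat ρ ∨ B.Sat ρ
  | .all A => ∀ n : ℕ, A.Sat (consEnv n ρ)
  | .ex A => ∃ n : ℕ, A.Sat (consEnv n ρ)

/-- Truth of a sentence in the standard model. -/
def sentTrue (A : Sentence) : Prop := A.1.Sat (fun _ => 0)

/-- Substitution of a closed term `t` for variable `k` in a term. -/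
def Trm.sub (t : Trm) (k : ℕ) : Trm → Trm
  | .var i => if i = k then t else if k < i then .var (i - 1) else .var i
  | .zero => .zero
  | .one => .one
  | .add s u => .add (Trm.sub t k s) (Trm.sub t k u)
  | .mul s u => .mul (Trm.sub t k s) (Trm.sub t k u)

/-- Substitution of a closed term `t` for variable `k` in a formula. -/
def Fml.sub (t : Trm) : Fml → ℕ → Fml
  | .eq s u, k => .eq (Trm.sub t k s) (Trm.sub t k u)
  | .ne s u, k => .ne (Trm.sub t k s) (Trm.sub t k u)
  | .and A B, k => .and (A.sub t k) (B.sub t k)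
  | .or A B, k => .or (A.sub t k) (B.sub t k)
  | .all A, k => .all (A.sub t (k + 1))
  | .ex A, k => .ex (A.sub t (k + 1))

/-- The numeral `n̄`. -/
def numeral : ℕ → Trm
  | 0 => .zero
  | n + 1 => .add (numeral n) .one

theorem Trm.cu_mono : ∀ (t : Trm) {j k : ℕ}, j ≤ k → t.cu j = true → t.cu k = true := by
  intro t
  induction t with
  | var i =>
    intro j k h ht
    simp only [Trm.cu, decide_eq_true_eq] at *
    omega
  | zero => intros; rfl
  | one => intros; rfl
  | add s u ihs ihu =>
    intro j k h ht
    simp only [Trm.cu, Bool.and_eq_true] at *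
    exact ⟨ihs h ht.1, ihu h ht.2⟩
  | mul s u ihs ihu =>
    intro j k h ht
    simp only [Trm.cu, Bool.and_eq_true] at *
    exact ⟨ihs h ht.1, ihu h ht.2⟩

theorem Trm.cu_sub : ∀ (s : Trm) {k : ℕ} {t : Trm},
    t.cu 0 = true → s.cu (k + 1) = true → (Trm.sub t k s).cu k = true := by
  intro s
  induction s with
  | var i =>
    intro k t ht hs
    simp only [Trm.cu, decide_eq_true_eq] at hs
    simp only [Trm.sub]
    by_cases h : i = k
    · rw [if_pos h]
      exact Trm.cu_mono t (Nat.zero_le k) ht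
    · have h2 : ¬ k < i := by omega
      rw [if_neg h, if_neg h2]
      simp only [Trm.cu, decide_eq_true_eq]
      omega
  | zero => intros; rfl
  | one => intros; rfl
  | add s u ihs ihu =>
    intro k t ht hs
    simp only [Trm.cu, Bool.and_eq_true] at hs
    simp only [Trm.sub, Trm.cu, Bool.and_eq_true]
    exact ⟨ihs ht hs.1, ihu ht hs.2⟩
  | mul s u ihs ihu =>
    intro k t ht hs
    simp only [Trm.cu, Bool.and_eq_true] at hs
    simp only [Trm.sub, Trm.cu, Bool.and_eq_true]
    exact ⟨ihs ht hs.1, ihu ht hs.2⟩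

theorem Fml.cu_sub : ∀ (A : Fml) {k : ℕ} {t : Trm},
    t.cu 0 = true → A.cu (k + 1) = true → (A.sub t k).cu k = true := by
  intro A
  induction A with
  | eq s u =>
    intro k t ht hA
    simp only [Fml.cu, Bool.and_eq_true] at hA
    simp only [Fml.sub, Fml.cu, Bool.and_eq_true]
    exact ⟨Trm.cu_sub s ht hA.1, Trm.cu_sub u ht hA.2⟩
  | ne s u =>
    intro k t ht hA
    simp only [Fml.cu, Bool.and_eq_true] at hA
    simp only [Fml.sub, Fml.cu, Bool.and_eq_true]
    exact ⟨Trm.cu_sub s ht hA.1, Trm.cu_sub u ht hA.2⟩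
  | and A B ihA ihB =>
    intro k t ht h
    simp only [Fml.cu, Bool.and_eq_true] at h
    simp only [Fml.sub, Fml.cu, Bool.and_eq_true]
    exact ⟨ihA ht h.1, ihB ht h.2⟩
  | or A B ihA ihB =>
    intro k t ht h
    simp only [Fml.cu, Bool.and_eq_true] at h
    simp only [Fml.sub, Fml.cu, Bool.and_eq_true]
    exact ⟨ihA ht h.1, ihB ht h.2⟩
  | all A ihA =>
    intro k t ht h
    simp only [Fml.cu] at h
    simp only [Fml.sub, Fml.cu]
    exact ihA ht h
  | ex A ihA =>
    intro k t ht h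
    simp only [Fml.cu] at h
    simp only [Fml.sub, Fml.cu]
    exact ihA ht h

theorem numeral_cu : ∀ n : ℕ, (numeral n).cu 0 = true := by
  intro n
  induction n with
  | zero => rfl
  | succ n ih => simp [numeral, Trm.cu, ih]

/-- Negation (de Morgan dual) of a formula in negation normal form. -/
def Fml.neg : Fml → Fml
  | .eq s t => .ne s t
  | .ne s t => .eq s t
  | .and A B => .or A.neg B.neg
  | .or A B => .and A.neg B.neg
  | .all A => .ex A.neg
  | .ex A => .all A.neg

theorem Fml.cu_neg : ∀ (A : Fml) {k : ℕ}, A.cu k = true → A.neg.cu k = true := by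
  intro A
  induction A with
  | eq s u => intro k h; simpa [Fml.cu, Fml.neg] using h
  | ne s u => intro k h; simpa [Fml.cu, Fml.neg] using h
  | and A B ihA ihB =>
    intro k h
    simp only [Fml.cu, Bool.and_eq_true] at h
    simp only [Fml.neg, Fml.cu, Bool.and_eq_true]
    exact ⟨ihA h.1, ihB h.2⟩
  | or A B ihA ihB =>
    intro k h
    simp only [Fml.cu, Bool.and_eq_true] at h
    simp only [Fml.neg, Fml.cu, Bool.and_eq_true]
    exact ⟨ihA h.1, ihB h.2⟩
  | all A ihA =>
    intro k h
    simp only [Fml.cu] at h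
    simp only [Fml.neg, Fml.cu]
    exact ihA h
  | ex A ihA =>
    intro k h
    simp only [Fml.cu] at h
    simp only [Fml.neg, Fml.cu]
    exact ihA h

/-- Conjunction of sentences. -/
def sAnd (A B : Sentence) : Sentence :=
  ⟨.and A.1 B.1, by simp [Fml.cu, A.2, B.2]⟩

/-- Disjunction of sentences. -/
def sOr (A B : Sentence) : Sentence :=
  ⟨.or A.1 B.1, by simp [Fml.cu, A.2, B.2]⟩

/-- Negation of a sentence. -/
def sNeg (A : Sentence) : Sentence := ⟨A.1.neg, Fml.cu_neg A.1 A.2⟩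

/-- The sentence `∀x A(x)`, for `A` with (at most) one free variable. -/
def sAll (A : Fml) (h : A.cu 1 = true) : Sentence := ⟨.all A, by simpa [Fml.cu] using h⟩

/-- The sentence `∃x A(x)`, for `A` with (at most) one free variable. -/
def sEx (A : Fml) (h : A.cu 1 = true) : Sentence := ⟨.ex A, by simpa [Fml.cu] using h⟩

/-- The instance `A(n̄)` of a formula `A` with one free variable. -/
def sInst (A : Fml) (h : A.cu 1 = true) (n : ℕ) : Sentence :=
  ⟨A.sub (numeral n) 0, Fml.cu_sub A (numeral_cu n) h⟩

/-- Literals: atomic and negated atomic formulas. -/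
def Fml.isLiteral : Fml → Bool
  | .eq _ _ => true
  | .ne _ _ => true
  | _ => false

/-- Quantifier free formulas. -/
def Fml.qf : Fml → Bool
  | .eq _ _ => true
  | .ne _ _ => true
  | .and A B => A.qf && B.qf
  | .or A B => A.qf && B.qf
  | .all _ => false
  | .ex _ => false

/-- An axiom is a sequent containing a true closed literal. -/
def IsAxiom (Γ : Finset Sentence) : Prop :=
  ∃ A ∈ Γ, A.1.isLiteral = true ∧ sentTrue A

/-- A sequent is true if some member is true. -/
def SeqTrue (Γ : Finset Sentence) : Prop := ∃ A ∈ Γ, sentTrue A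


/-! ### A primitive recursive Gödel numbering of terms, sentences and sequents -/

/-- Gödel number of a term. -/
def Trm.enc : Trm → ℕ
  | .var i => 5 * i
  | .zero => 1
  | .one => 2
  | .add s t => 5 * Nat.pair s.enc t.enc + 3
  | .mul s t => 5 * Nat.pair s.enc t.enc + 4

/-- Fuelled decoding of terms. -/
def Trm.dec : ℕ → ℕ → Option Trm
  | 0, _ => none
  | fuel + 1, n =>
    if n % 5 = 0 then some (.var (n / 5))
    else if n % 5 = 1 then some .zero
    else if n % 5 = 2 then some .one
    else if n % 5 = 3 then
      match Trm.dec fuel (n / 5).unpair.1, Trm.dec fuel (n / 5).unpair.2 with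
      | some s, some t => some (.add s t)
      | _, _ => none
    else
      match Trm.dec fuel (n / 5).unpair.1, Trm.dec fuel (n / 5).unpair.2 with
      | some s, some t => some (.mul s t)
      | _, _ => none

theorem Trm.dec_enc : ∀ (t : Trm) (fuel : ℕ), t.enc < fuel → Trm.dec fuel t.enc = some t := by
  intro t
  induction t with
  | var i =>
    intro fuel h
    match fuel with
    | f + 1 =>
      have h0 : (5 * i) % 5 = 0 := by omega
      have h1 : (5 * i) / 5 = i := by omega
      simp [Trm.dec, Trm.enc, h0, h1]
  | zero =>
    intro fuel h
    match fuel with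
    | f + 1 => simp [Trm.dec, Trm.enc]
  | one =>
    intro fuel h
    match fuel with
    | f + 1 => simp [Trm.dec, Trm.enc]
  | add s u ihs ihu =>
    intro fuel h
    match fuel with
    | f + 1 =>
      simp only [Trm.enc] at h ⊢
      set p := Nat.pair s.enc u.enc with hp
      have h0 : (5 * p + 3) % 5 = 3 := by omega
      have h1 : (5 * p + 3) / 5 = p := by omega
      have hs : s.enc < f := by
        have := Nat.left_le_pair s.enc u.enc
        omega
      have hu : u.enc < f := by
        have := Nat.right_le_pair s.enc u.enc
        omega
      simp only [Trm.dec, h0, h1]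
      rw [hp, Nat.unpair_pair, ihs f hs, ihu f hu]
      simp
  | mul s u ihs ihu =>
    intro fuel h
    match fuel with
    | f + 1 =>
      simp only [Trm.enc] at h ⊢
      set p := Nat.pair s.enc u.enc with hp
      have h0 : (5 * p + 4) % 5 = 4 := by omega
      have h1 : (5 * p + 4) / 5 = p := by omega
      have hs : s.enc < f := by
        have := Nat.left_le_pair s.enc u.enc
        omega
      have hu : u.enc < f := by
        have := Nat.right_le_pair s.enc u.enc
        omega
      simp only [Trm.dec, h0, h1]
      rw [hp, Nat.unpair_pair, ihs f hs, ihu f hu]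
      simp

instance : Encodable Trm :=
  ⟨Trm.enc, fun n => Trm.dec (n + 1) n, fun t => Trm.dec_enc t _ (Nat.lt_succ_self _)⟩

/-- Gödel number of a formula. -/
def Fml.enc : Fml → ℕ
  | .eq s t => 6 * Nat.pair s.enc t.enc
  | .ne s t => 6 * Nat.pair s.enc t.enc + 1
  | .and A B => 6 * Nat.pair A.enc B.enc + 2
  | .or A B => 6 * Nat.pair A.enc B.enc + 3
  | .all A => 6 * A.enc + 4
  | .ex A => 6 * A.enc + 5

/-- Fuelled decoding of formulas. -/
def Fml.dec : ℕ → ℕ → Option Fml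
  | 0, _ => none
  | fuel + 1, n =>
    if n % 6 = 0 then
      match Encodable.decode (α := Trm) (n / 6).unpair.1,
            Encodable.decode (α := Trm) (n / 6).unpair.2 with
      | some s, some t => some (.eq s t)
      | _, _ => none
    else if n % 6 = 1 then
      match Encodable.decode (α := Trm) (n / 6).unpair.1,
            Encodable.decode (α := Trm) (n / 6).unpair.2 with
      | some s, some t => some (.ne s t)
      | _, _ => none
    else if n % 6 = 2 then
      match Fml.dec fuel (n / 6).unpair.1, Fml.dec fuel (n / 6).unpair.2 with
      | some A, some B => some (.and A B)
      | _, _ => none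
    else if n % 6 = 3 then
      match Fml.dec fuel (n / 6).unpair.1, Fml.dec fuel (n / 6).unpair.2 with
      | some A, some B => some (.or A B)
      | _, _ => none
    else if n % 6 = 4 then
      match Fml.dec fuel (n / 6) with
      | some A => some (.all A)
      | none => none
    else
      match Fml.dec fuel (n / 6) with
      | some A => some (.ex A)
      | none => none

theorem Fml.dec_enc : ∀ (A : Fml) (fuel : ℕ), A.enc < fuel → Fml.dec fuel A.enc = some A := by
  intro A
  induction A with
  | eq s u =>
    intro fuel h
    match fuel with
    | f + 1 =>
      simp only [Fml.enc] at h ⊢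
      set p := Nat.pair s.enc u.enc with hp
      have h0 : (6 * p) % 6 = 0 := by omega
      have h1 : (6 * p) / 6 = p := by omega
      have hds : Encodable.decode (α := Trm) s.enc = some s := Encodable.encodek s
      have hdu : Encodable.decode (α := Trm) u.enc = some u := Encodable.encodek u
      simp only [Fml.dec, h0, h1]
      rw [hp, Nat.unpair_pair, hds, hdu]
      simp
  | ne s u =>
    intro fuel h
    match fuel with
    | f + 1 =>
      simp only [Fml.enc] at h ⊢
      set p := Nat.pair s.enc u.enc with hp
      have h0 : (6 * p + 1) % 6 = 1 := by omega
      have h1 : (6 * p + 1) / 6 = p := by omega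
      have hds : Encodable.decode (α := Trm) s.enc = some s := Encodable.encodek s
      have hdu : Encodable.decode (α := Trm) u.enc = some u := Encodable.encodek u
      simp only [Fml.dec, h0, h1]
      rw [hp, Nat.unpair_pair, hds, hdu]
      simp
  | and A B ihA ihB =>
    intro fuel h
    match fuel with
    | f + 1 =>
      simp only [Fml.enc] at h ⊢
      set p := Nat.pair A.enc B.enc with hp
      have h0 : (6 * p + 2) % 6 = 2 := by omega
      have h1 : (6 * p + 2) / 6 = p := by omega
      have hA : A.enc < f := by
        have := Nat.left_le_pair A.enc B.enc
        omega
      have hB : B.enc < f := by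
        have := Nat.right_le_pair A.enc B.enc
        omega
      simp only [Fml.dec, h0, h1]
      rw [hp, Nat.unpair_pair, ihA f hA, ihB f hB]
      simp
  | or A B ihA ihB =>
    intro fuel h
    match fuel with
    | f + 1 =>
      simp only [Fml.enc] at h ⊢
      set p := Nat.pair A.enc B.enc with hp
      have h0 : (6 * p + 3) % 6 = 3 := by omega
      have h1 : (6 * p + 3) / 6 = p := by omega
      have hA : A.enc < f := by
        have := Nat.left_le_pair A.enc B.enc
        omega
      have hB : B.enc < f := by
        have := Nat.right_le_pair A.enc B.enc
        omega
      simp only [Fml.dec, h0, h1]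
      rw [hp, Nat.unpair_pair, ihA f hA, ihB f hB]
      simp
  | all A ihA =>
    intro fuel h
    match fuel with
    | f + 1 =>
      simp only [Fml.enc] at h ⊢
      have h0 : (6 * A.enc + 4) % 6 = 4 := by omega
      have h1 : (6 * A.enc + 4) / 6 = A.enc := by omega
      have hA : A.enc < f := by omega
      simp [Fml.dec, h0, h1, ihA f hA]
  | ex A ihA =>
    intro fuel h
    match fuel with
    | f + 1 =>
      simp only [Fml.enc] at h ⊢
      have h0 : (6 * A.enc + 5) % 6 = 5 := by omega
      have h1 : (6 * A.enc + 5) / 6 = A.enc := by omega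
      have hA : A.enc < f := by omega
      simp [Fml.dec, h0, h1, ihA f hA]

instance : Encodable Fml :=
  ⟨Fml.enc, fun n => Fml.dec (n + 1) n, fun A => Fml.dec_enc A _ (Nat.lt_succ_self _)⟩

/-- Gödel number of a sentence. -/
def encF (A : Sentence) : ℕ := Encodable.encode A

/-- Gödel number of a sequent (finite set of sentences). -/
def encS (Γ : Finset Sentence) : ℕ := Encodable.encode Γ

/-- Decode a Gödel number into a sentence (with a default value). -/
def decF (n : ℕ) : Sentence := (Encodable.decode (α := Sentence) n).getD ⟨.eq .zero .zero, rfl⟩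

/-- Decode a Gödel number into a sequent (with a default value). -/
def decS (n : ℕ) : Finset Sentence := (Encodable.decode (α := Finset Sentence) n).getD ∅

/-! ### Tupling of natural numbers, with projections -/

/-- Code of a finite sequence (tuple) of natural numbers; codes are nonzero. -/
def tup (l : List ℕ) : ℕ := Encodable.encode l + 1

/-- The finite sequence coded by a natural number. -/
def untup (a : ℕ) : List ℕ := Denumerable.ofNat (List ℕ) (a - 1)

/-- The `i`-th projection `(a)_i`. -/
def proj (a i : ℕ) : ℕ := (untup a).getD i 0

/-- `a` codes a finite sequence (every nonzero number does, bijectively). -/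
def InSeq (a : ℕ) : Prop := a ≠ 0

/-- The code of the empty sequence `⟨⟩` (the root). -/
def rootSeq : ℕ := tup []

/-- The code of `σ⌢i`. -/
def snoc (σ i : ℕ) : ℕ := tup (untup σ ++ [i])

/-! ### Names for the inference rules -/

def axC : ℕ := 1
def andC : ℕ := 2
def orC : ℕ := 3
def omC : ℕ := 4
def exC : ℕ := 5
def cutC : ℕ := 6
def omrepC : ℕ := 7

/-- The end sequent of a (code of a) proof or proof node: `(a)_1` if the rule
`(a)_0` carries no main formula, and `(a)_1 ∪ {(a)_2}` otherwise. -/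
def EndS (a : ℕ) : Finset Sentence :=
  if proj a 0 = cutC ∨ proj a 0 = axC ∨ proj a 0 = omrepC then decS (proj a 1)
  else decS (proj a 1) ∪ {decF (proj a 2)}

/-! ### Local codes of ω-proofs -/

/-- Local codes of `ω`-proofs, in Tait style.  The three `Bool` parameters
respectively allow the cut rule, restrict the `ω`-rule to indices of primitive
recursive functions, and allow the vacuous `ω`-repetition rule. -/
inductive CGen (c p r : Bool) : ℕ → Prop
  | ax (Γ : Finset Sentence) (h : IsAxiom Γ) : CGen c p r (tup [axC, encS Γ])
  | and {a b : ℕ} (Γ : Finset Sentence) (A B : Sentence)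
      (ha : CGen c p r a) (hb : CGen c p r b)
      (ea : EndS a = Γ ∪ {A}) (eb : EndS b = Γ ∪ {B}) :
      CGen c p r (tup [andC, encS Γ, encF (sAnd A B), a, b])
  | or {a : ℕ} (Γ : Finset Sentence) (A B : Sentence) (ha : CGen c p r a)
      (ea : EndS a = Γ ∪ {A, B}) :
      CGen c p r (tup [orC, encS Γ, encF (sOr A B), a])
  | om {e : ℕ} (Γ : Finset Sentence) (A : Fml) (hA : A.cu 1 = true)
      (hp : p = true → PrimIndex e)
      (htot : ∀ n, (peval e n).Dom)
      (hmem : ∀ n, CGen c p r ((peval e n).get (htot n)))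
      (hend : ∀ n, EndS ((peval e n).get (htot n)) = Γ ∪ {sInst A hA n}) :
      CGen c p r (tup [omC, encS Γ, encF (sAll A hA), e])
  | ex {a : ℕ} (Γ : Finset Sentence) (A : Fml) (hA : A.cu 1 = true) (n : ℕ)
      (ha : CGen c p r a) (ea : EndS a = Γ ∪ {sInst A hA n}) :
      CGen c p r (tup [exC, encS Γ, encF (sEx A hA), a])
  | cut {a b : ℕ} (hc : c = true) (Γ : Finset Sentence) (C : Sentence)
      (ha : CGen c p r a) (hb : CGen c p r b)
      (ea : EndS a = Γ ∪ {C}) (eb : EndS b = Γ ∪ {sNeg C}) :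
      CGen c p r (tup [cutC, encS Γ, encF C, a, b])
  | omrep {e : ℕ} (hr : r = true) (Γ : Finset Sentence) (hp : PrimIndex e)
      (htot : ∀ n, (peval e n).Dom)
      (hmem : ∀ n, CGen c p r ((peval e n).get (htot n)))
      (hend : ∀ n, EndS ((peval e n).get (htot n)) = Γ) :
      CGen c p r (tup [omrepC, encS Γ, e])

/-- `C_rec`: recursive local codes of `ω`-proofs. -/
def Crec : ℕ → Prop := CGen true false false

/-- `C_rec^-`: the cut free fragment of `C_rec`. -/
def CrecM : ℕ → Prop := CGen false false false

/-- `C_prec`: primitive recursive local codes of `ω`-proofs. -/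
def Cprec : ℕ → Prop := CGen true true false

/-- `C_prec^-`: the cut free fragment of `C_prec`. -/
def CprecM : ℕ → Prop := CGen false true false

/-- `C_prec^{ω-rep}`: `C_prec` with the vacuous `ω`-repetition rule. -/
def CprecRep : ℕ → Prop := CGen true true true

/-! ### ω-proofs as well founded trees of sequents -/

/-- `σ` is a node of the tree `T_π = {σ ∈ Seq : π(σ) ∈ Seq}`. -/
def TreeOf (π : ℕ → ℕ) (σ : ℕ) : Prop := σ ≠ 0 ∧ π σ ≠ 0

/-- The tree `T_π` is well founded: it has no infinite branch. -/
def WFTree (π : ℕ → ℕ) : Prop :=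
  ¬ ∃ f : ℕ → ℕ, ∀ n : ℕ, TreeOf π (tup ((List.range n).map f))

/-- The inference at an inner node of an `ω`-proof is a correct instance of one
of the rules of Tait-style `ω`-arithmetic. -/
def CorrectInner (π : ℕ → ℕ) (σ : ℕ) : Prop :=
  (∃ (Γ : Finset Sentence) (A B : Sentence),
    π σ = tup [andC, encS Γ, encF (sAnd A B)] ∧
    TreeOf π (snoc σ 0) ∧ TreeOf π (snoc σ 1) ∧ ¬ TreeOf π (snoc σ 2) ∧
    EndS (π (snoc σ 0)) = Γ ∪ {A} ∧ EndS (π (snoc σ 1)) = Γ ∪ {B}) ∨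
  (∃ (Γ : Finset Sentence) (A B : Sentence),
    π σ = tup [orC, encS Γ, encF (sOr A B)] ∧
    TreeOf π (snoc σ 0) ∧ ¬ TreeOf π (snoc σ 1) ∧
    EndS (π (snoc σ 0)) = Γ ∪ {A, B}) ∨
  (∃ (Γ : Finset Sentence) (A : Fml) (hA : A.cu 1 = true),
    π σ = tup [omC, encS Γ, encF (sAll A hA)] ∧
    (∀ n : ℕ, TreeOf π (snoc σ n)) ∧
    (∀ n : ℕ, EndS (π (snoc σ n)) = Γ ∪ {sInst A hA n})) ∨
  (∃ (Γ : Finset Sentence) (A : Fml) (hA : A.cu 1 = true) (n : ℕ),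
    π σ = tup [exC, encS Γ, encF (sEx A hA)] ∧
    TreeOf π (snoc σ 0) ∧ ¬ TreeOf π (snoc σ 1) ∧
    EndS (π (snoc σ 0)) = Γ ∪ {sInst A hA n}) ∨
  (∃ (Γ : Finset Sentence) (C : Sentence),
    π σ = tup [cutC, encS Γ, encF C] ∧
    TreeOf π (snoc σ 0) ∧ TreeOf π (snoc σ 1) ∧ ¬ TreeOf π (snoc σ 2) ∧
    EndS (π (snoc σ 0)) = Γ ∪ {C} ∧ EndS (π (snoc σ 1)) = Γ ∪ {sNeg C})

/-- Local correctness of a function `π : ℕ → ℕ` viewed as a tree of sequents: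
all conditions in the definition of `ω`-proof except well-foundedness. -/
structure LocallyCorrect (π : ℕ → ℕ) : Prop where
  /-- values outside `Seq` are `0` -/
  nonseq : ∀ σ, ¬ InSeq (π σ) → π σ = 0
  /-- `T_π` is closed under initial segments -/
  downward : ∀ σ τ, TreeOf π σ → τ ≠ 0 → untup τ <+: untup σ → TreeOf π τ
  /-- children come first -/
  mono : ∀ σ i j, i < j → TreeOf π (snoc σ j) → TreeOf π (snoc σ i)
  /-- top nodes are axioms -/
  top : ∀ σ, TreeOf π σ → ¬ TreeOf π (snoc σ 0) →
    ∃ Γ : Finset Sentence, IsAxiom Γ ∧ π σ = tup [axC, encS Γ]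
  /-- inner nodes are correct inferences -/
  inner : ∀ σ, TreeOf π σ → TreeOf π (snoc σ 0) → CorrectInner π σ

/-- `π : ℕ → ℕ` is an `ω`-proof. -/
structure IsOmegaProof (π : ℕ → ℕ) extends LocallyCorrect π : Prop where
  /-- the tree `T_π` is well founded -/
  wf : WFTree π

/-- An `ω`-proof is cut free if no node is labelled `cut`. -/
def CutFree (π : ℕ → ℕ) : Prop := ∀ σ, TreeOf π σ → proj (π σ) 0 ≠ cutC

/-! ### The ω-proof `π(a)` coded by a local code `a` -/

open Classical in
/-- The code of the subproof at child `n` of the proof coded by `a`. -/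
noncomputable def childCode (a n : ℕ) : ℕ :=
  if proj a 0 = omC then
    (if h : (peval (proj a 3) n).Dom then (peval (proj a 3) n).get h else 0)
  else if proj a 0 = andC ∨ proj a 0 = orC ∨ proj a 0 = exC ∨ proj a 0 = cutC then
    proj a (n + 3)
  else 0

/-- Walk down a local code along a path. -/
noncomputable def walkCode (a : ℕ) : List ℕ → ℕ
  | [] => a
  | i :: l => walkCode (childCode a i) l

/-- The node label `⟨R,Γ,A⟩` (or `⟨Ax,Γ⟩`) determined by a local code. -/
def nodeVal (b : ℕ) : ℕ :=
  if proj b 0 = axC then tup [axC, proj b 1]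
  else if proj b 0 = andC ∨ proj b 0 = orC ∨ proj b 0 = omC ∨ proj b 0 = exC ∨ proj b 0 = cutC then
    tup [proj b 0, proj b 1, proj b 2]
  else 0

/-- The `ω`-proof `π(a)` determined by a local code `a` (with value `0` at all
other arguments). -/
noncomputable def piOf (a : ℕ) (σ : ℕ) : ℕ :=
  if σ = 0 then 0 else nodeVal (walkCode a (untup σ))

/-! ### Indices (global codes) of recursive and primitive recursive ω-proofs -/

/-- `I_rec`: `a` is an index of a recursive `ω`-proof. -/
def Irec (a : ℕ) : Prop :=
  ∃ h : ∀ n, (peval a n).Dom, IsOmegaProof (fun n => (peval a n).get (h n))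

/-- `I_prec`: `a` is an index of a primitive recursive `ω`-proof. -/
def Iprec (a : ℕ) : Prop :=
  ∃ f : ℕ → ℕ, Nat.Primrec f ∧ (∀ n, peval a n = Part.some (f n)) ∧ IsOmegaProof f

/-- `I_prec^-`: `a` is an index of a primitive recursive cut free `ω`-proof. -/
def IprecM (a : ℕ) : Prop :=
  ∃ f : ℕ → ℕ, Nat.Primrec f ∧ (∀ n, peval a n = Part.some (f n)) ∧
    IsOmegaProof f ∧ CutFree f

/-! ### Ordinal lengths -/

open Classical in
/-- `x + 1` if `P` holds, and `0` otherwise. -/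
noncomputable def succIf (P : Prop) (x : Ordinal.{0}) : Ordinal.{0} :=
  if P then x + 1 else 0

/-- The ordinal rank of a node of the tree `T_π`:
`rank σ = sup {rank (σ⌢i) + 1 : σ⌢i ∈ T_π}`. -/
inductive NodeRank (π : ℕ → ℕ) : ℕ → Ordinal.{0} → Prop
  | mk (σ : ℕ) (o : ℕ → Ordinal.{0})
      (h : ∀ i, TreeOf π (snoc σ i) → NodeRank π (snoc σ i) (o i)) :
      NodeRank π σ (⨆ i, succIf (TreeOf π (snoc σ i)) (o i))

/-- The ordinal length of a local code:  `|⟨Ax,Γ⟩| = 0`,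
`|⟨R,Γ,A,a₁,…,a_k⟩| = sup{|a₁|,…,|a_k|} + 1`, and
`|⟨ω,Γ,∀xA(x),e⟩| = sup{|⟨e⟩(n)| + 1 : n ∈ ℕ}`. -/
inductive CLen : ℕ → Ordinal.{0} → Prop
  | ax (g : ℕ) : CLen (tup [axC, g]) 0
  | one (R g x a : ℕ) (o : Ordinal.{0}) (hR : R = orC ∨ R = exC) (h : CLen a o) :
      CLen (tup [R, g, x, a]) (o + 1)
  | two (R g x a b : ℕ) (oa ob : Ordinal.{0}) (hR : R = andC ∨ R = cutC)
      (ha : CLen a oa) (hb : CLen b ob) :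
      CLen (tup [R, g, x, a, b]) ((oa ⊔ ob) + 1)
  | om (g x e : ℕ) (h : ∀ n, (peval e n).Dom) (o : ℕ → Ordinal.{0})
      (ho : ∀ n, CLen ((peval e n).get (h n)) (o n)) :
      CLen (tup [omC, g, x, e]) (⨆ n, o n + 1)

/-- The ordinal `|a|` of a notation `a ∈ O`:  `|1| = 0`, `|2^a| = |a| + 1`,
`|3·5^e| = sup{|⟨e⟩(n)| : n ∈ ℕ}`. -/
inductive KOrd : ℕ → Ordinal.{0} → Prop
  | one : KOrd 1 0
  | step {a : ℕ} {o : Ordinal.{0}} : KOrd a o → KOrd (2 ^ a) (o + 1)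
  | lim {e : ℕ} (h : ∀ n, (peval e n).Dom) (o : ℕ → Ordinal.{0})
      (ho : ∀ n, KOrd ((peval e n).get (h n)) (o n)) :
      KOrd (3 * 5 ^ e) (⨆ n, o n)


open Classical in
/-- One step of the sequence `a(f)` determined by a local code. -/
noncomputable def branchStep (b k : ℕ) : Option ℕ :=
  if (∃ (Γ : Finset Sentence) (A B : Sentence) (b₀ b₁ : ℕ),
        b = tup [andC, encS Γ, encF (sAnd A B), b₀, b₁]) ∨
     (∃ (Γ : Finset Sentence) (C : Sentence) (b₀ b₁ : ℕ),
        b = tup [cutC, encS Γ, encF C, b₀, b₁]) then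
    some (proj b (3 + k % 2))
  else if ∃ (Γ : Finset Sentence) (A B : Sentence) (c : ℕ),
      b = tup [orC, encS Γ, encF (sOr A B), c] then
    some (proj b 3)
  else if ∃ (Γ : Finset Sentence) (A : Fml) (hA : A.cu 1 = true) (e : ℕ),
      b = tup [omC, encS Γ, encF (sAll A hA), e] then
    (if h : (peval (proj b 3) k).Dom then some ((peval (proj b 3) k).get h) else none)
  else none

/-- The sequence `a(f) = ⟨a₀,a₁,…⟩`:  `chain a f i = some aᵢ` if the `i`-th
element of the sequence is defined, and `none` otherwise. -/
noncomputable def chain (a : ℕ) (f : ℕ → ℕ) : ℕ → Option ℕ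
  | 0 => some a
  | i + 1 =>
    match chain a f i with
    | none => none
    | some b => branchStep b (f i)

open Encodable

/-! ### Primitive recursive computation of Gödel numbers of sequents -/

/-- Insertion into a strictly increasing list of natural numbers. -/
def sortedInsert (x : ℕ) (l : List ℕ) : List ℕ :=
  l.filter (· < x) ++ x :: l.filter (x < ·)

/-- `l` is the strictly increasing list of the Gödel numbers of the members of `Γ`. -/
def Lists (l : List ℕ) (Γ : Finset Sentence) : Prop :=
  l.Pairwise (· < ·) ∧ ∀ x, x ∈ l ↔ ∃ A ∈ Γ, encF A = x

theorem encode_map_encode {α : Type*} [Encodable α] (l : List α) :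
    encode (l.map encode) = encode l := by
  induction l with
  | nil => rfl
  | cons a l ih => simp [ih]

theorem Lists.encS_eq {l : List ℕ} {Γ : Finset Sentence} (h : Lists l Γ) :
    encS Γ = encode l := by
  obtain ⟨s, hs, hp, hn⟩ : ∃ s : List Sentence, encS Γ = encode s ∧
      s.Pairwise (fun a b => encode a ≤ encode b) ∧ (s : Multiset Sentence) = Γ.1 := by
    let r : Sentence → Sentence → Prop := fun a b => encode a ≤ encode b
    have : IsTrans Sentence r := ⟨fun _ _ _ => le_trans⟩
    have : Std.Antisymm r := ⟨fun _ _ h h' => encode_injective (le_antisymm h h')⟩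
    have : Std.Total r := ⟨fun _ _ => le_total _ _⟩
    let dr : DecidableRel r := fun a b => Nat.decLe _ _
    exact ⟨Γ.1.sort r, rfl, Multiset.pairwise_sort _ _, Multiset.sort_eq _ _⟩
  have hnd : s.Nodup := by
    have := Γ.2
    rwa [← hn, Multiset.coe_nodup] at this
  have hmem : ∀ A, A ∈ s ↔ A ∈ Γ := fun A => by
    rw [← Finset.mem_val, ← hn, Multiset.mem_coe]
  rw [hs, ← encode_map_encode s]
  congr 1
  have hlt : (s.map encode).Pairwise (· < ·) := by
    rw [List.pairwise_map]
    refine (hp.and hnd).imp fun {a b} hab => lt_of_le_of_ne hab.1 fun he => hab.2 ?_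
    exact encode_injective he
  refine List.Perm.eq_of_pairwise (le := (· < ·)) (fun a b _ _ h1 h2 => by omega) hlt h.1 ?_
  refine (List.perm_ext_iff_of_nodup (hlt.imp ne_of_lt) (h.1.imp ne_of_lt)).2 fun x => ?_
  rw [h.2, List.mem_map]
  simp only [hmem, encF]

theorem Lists.insert {l : List ℕ} {Γ : Finset Sentence} (h : Lists l Γ) (A : Sentence) :
    Lists (sortedInsert (encF A) l) (Γ ∪ {A}) := by
  constructor
  · unfold sortedInsert
    rw [List.pairwise_append, List.pairwise_cons]
    refine ⟨h.1.filter _, ⟨fun y hy => ?_, h.1.filter _⟩, fun a ha b hb => ?_⟩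
    · simpa using (List.mem_filter.1 hy).2
    · simp only [List.mem_filter, decide_eq_true_eq, List.mem_cons] at ha hb
      omega
  · intro x
    have := h.2 x
    simp only [sortedInsert, List.mem_append, List.mem_filter, decide_eq_true_eq, List.mem_cons,
      Finset.mem_union, Finset.mem_singleton, or_and_right, exists_or, exists_eq_left, ← this]
    constructor
    · rintro (h | h | h)
      exacts [Or.inl h.1, Or.inr h.symm, Or.inl h.1]
    · rintro (h | h)
      · rcases lt_trichotomy x (encF A) with h' | h' | h'
        exacts [Or.inl ⟨h, h'⟩, Or.inr (Or.inl h'), Or.inr (Or.inr ⟨h, h'⟩)]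
      · exact Or.inr (Or.inl h.symm)

theorem lists_singleton (A : Sentence) : Lists [encF A] {A} :=
  ⟨List.pairwise_singleton _ _, fun x => by
    rw [List.mem_singleton, eq_comm]; simp only [Finset.mem_singleton, exists_eq_left]⟩

theorem primrec_sortedInsert : Primrec₂ sortedInsert := by
  have h1 : Primrec₂ fun (l : List ℕ) (x : ℕ) => l.filter (fun a => a < x) :=
    PrimrecRel.listFilter Primrec.nat_lt
  have h2 : Primrec₂ fun (l : List ℕ) (x : ℕ) => l.filter (fun a => x < a) :=
    PrimrecRel.listFilter (R := fun a x => x < a) Primrec.nat_lt.swap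
  exact Primrec.list_append.comp (h1.comp Primrec.snd Primrec.fst)
    (Primrec.list_cons.comp Primrec.fst (h2.comp Primrec.snd Primrec.fst))

theorem primrec_tup : Primrec tup := Primrec.succ.comp Primrec.encode

theorem primrec_untup : Primrec untup := (Primrec.ofNat _).comp Primrec.pred

theorem primrec_proj : Primrec₂ proj :=
  (Primrec.list_getD 0).comp (primrec_untup.comp Primrec.fst) Primrec.snd

/-! ### Codes and their decodings -/

@[simp] theorem untup_tup (l : List ℕ) : untup (tup l) = l := by
  simp [untup, tup]

@[simp] theorem proj_tup (l : List ℕ) (i : ℕ) : proj (tup l) i = l.getD i 0 := by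
  simp [proj]

@[simp] theorem proj_zero_left (i : ℕ) : proj 0 i = 0 := by
  have : untup 0 = [] := untup_tup []
  simp [proj, this]

theorem tup_ne_zero (l : List ℕ) : tup l ≠ 0 := Nat.succ_ne_zero _

@[simp] theorem decS_encS (Γ : Finset Sentence) : decS (encS Γ) = Γ := by
  simp [decS, encS]

@[simp] theorem decF_encF (A : Sentence) : decF (encF A) = A := by
  simp [decF, encF]

/-! ### Local codes determine `ω`-proofs -/

theorem childCode_ax (g n : ℕ) : childCode (tup [axC, g]) n = 0 := by
  simp [childCode, axC, omC, andC, orC, exC, cutC]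

theorem childCode_and (g x a b n : ℕ) :
    childCode (tup [andC, g, x, a, b]) n = [a, b].getD n 0 := by
  simp [childCode, omC, andC]

theorem childCode_or (g x a n : ℕ) : childCode (tup [orC, g, x, a]) n = [a].getD n 0 := by
  simp [childCode, omC, orC]

theorem childCode_ex (g x a n : ℕ) : childCode (tup [exC, g, x, a]) n = [a].getD n 0 := by
  simp [childCode, omC, exC]

theorem childCode_cut (g x a b n : ℕ) :
    childCode (tup [cutC, g, x, a, b]) n = [a, b].getD n 0 := by
  simp [childCode, omC, cutC]

theorem childCode_om (g x e n : ℕ) (h : (peval e n).Dom) :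
    childCode (tup [omC, g, x, e]) n = (peval e n).get h := by
  simp [childCode, h]

@[simp] theorem childCode_zero (n : ℕ) : childCode 0 n = 0 := by
  simp [childCode, omC, andC, orC, exC, cutC]

@[simp] theorem nodeVal_zero : nodeVal 0 = 0 := by
  simp [nodeVal, axC, omC, andC, orC, exC, cutC]

theorem nodeVal_ax (g : ℕ) : nodeVal (tup [axC, g]) = tup [axC, g] := by
  simp [nodeVal]

theorem nodeVal_and (g x a b : ℕ) : nodeVal (tup [andC, g, x, a, b]) = tup [andC, g, x] := by
  simp [nodeVal, andC, axC]

theorem nodeVal_or (g x a : ℕ) : nodeVal (tup [orC, g, x, a]) = tup [orC, g, x] := by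
  simp [nodeVal, orC, axC]

theorem nodeVal_om (g x e : ℕ) : nodeVal (tup [omC, g, x, e]) = tup [omC, g, x] := by
  simp [nodeVal, omC, axC]

theorem nodeVal_ex (g x a : ℕ) : nodeVal (tup [exC, g, x, a]) = tup [exC, g, x] := by
  simp [nodeVal, exC, axC]

theorem nodeVal_cut (g x a b : ℕ) : nodeVal (tup [cutC, g, x, a, b]) = tup [cutC, g, x] := by
  simp [nodeVal, cutC, axC]

theorem walkCode_zero (l : List ℕ) : walkCode 0 l = 0 := by
  induction l with
  | nil => rfl
  | cons i l ih => simpa [walkCode] using ih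

theorem walkCode_append (a : ℕ) (l l' : List ℕ) :
    walkCode a (l ++ l') = walkCode (walkCode a l) l' := by
  induction l generalizing a with
  | nil => rfl
  | cons i l ih => exact ih _

theorem piOf_snoc (a σ i : ℕ) :
    piOf a (snoc σ i) = nodeVal (childCode (walkCode a (untup σ)) i) := by
  simp [piOf, snoc, tup_ne_zero, walkCode_append, walkCode]

section

variable {c p : Bool} {a : ℕ}

theorem CGen.ne_zero (h : CGen c p false a) : a ≠ 0 := by
  cases h <;> exact tup_ne_zero _

theorem CGen.childCode (h : CGen c p false a) (i : ℕ) :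
    childCode a i = 0 ∨ CGen c p false (childCode a i) := by
  cases h with
  | ax => exact Or.inl (childCode_ax _ _)
  | and Γ A B ha hb =>
    rw [childCode_and]
    match i with
    | 0 => exact Or.inr ha
    | 1 => exact Or.inr hb
    | _ + 2 => exact Or.inl rfl
  | or Γ A B ha =>
    rw [childCode_or]
    match i with
    | 0 => exact Or.inr ha
    | _ + 1 => exact Or.inl rfl
  | om Γ A hA hp htot hmem =>
    rw [childCode_om _ _ _ _ (htot i)]
    exact Or.inr (hmem i)
  | ex Γ A hA n ha =>
    rw [childCode_ex]
    match i with
    | 0 => exact Or.inr ha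
    | _ + 1 => exact Or.inl rfl
  | cut hc Γ C ha hb =>
    rw [childCode_cut]
    match i with
    | 0 => exact Or.inr ha
    | 1 => exact Or.inr hb
    | _ + 2 => exact Or.inl rfl
  | omrep hr => simp at hr

theorem CGen.walkCode (h : CGen c p false a) (l : List ℕ) :
    walkCode a l = 0 ∨ CGen c p false (walkCode a l) := by
  induction l generalizing a with
  | nil => exact Or.inr h
  | cons i l ih =>
    rcases h.childCode i with h0 | h1
    · left
      rw [Shoen.walkCode, h0, walkCode_zero]
    · exact ih h1

theorem CGen.nodeVal_ne_zero (h : CGen c p false a) : nodeVal a ≠ 0 := by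
  cases h with
  | ax => rw [nodeVal_ax]; exact tup_ne_zero _
  | and => rw [nodeVal_and]; exact tup_ne_zero _
  | or => rw [nodeVal_or]; exact tup_ne_zero _
  | om => rw [nodeVal_om]; exact tup_ne_zero _
  | ex => rw [nodeVal_ex]; exact tup_ne_zero _
  | cut => rw [nodeVal_cut]; exact tup_ne_zero _
  | omrep hr => simp at hr

theorem CGen.endS_nodeVal (h : CGen c p false a) : EndS (nodeVal a) = EndS a := by
  cases h with
  | ax => rw [nodeVal_ax]
  | and => rw [nodeVal_and]; simp [EndS]
  | or => rw [nodeVal_or]; simp [EndS]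
  | om => rw [nodeVal_om]; simp [EndS]
  | ex => rw [nodeVal_ex]; simp [EndS]
  | cut => rw [nodeVal_cut]; simp [EndS]
  | omrep hr => simp at hr

theorem CGen.treeOf_iff (h : CGen c p false a) {σ : ℕ} :
    TreeOf (piOf a) σ ↔ σ ≠ 0 ∧ Shoen.walkCode a (untup σ) ≠ 0 := by
  refine and_congr_right fun hσ => ?_
  rw [piOf, if_neg hσ]
  rcases h.walkCode (untup σ) with h0 | h1
  · simp [h0]
  · simp [h1.ne_zero, h1.nodeVal_ne_zero]

theorem CGen.treeOf_snoc_iff (h : CGen c p false a) {σ i : ℕ} :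
    TreeOf (piOf a) (snoc σ i) ↔ Shoen.childCode (Shoen.walkCode a (untup σ)) i ≠ 0 := by
  rw [h.treeOf_iff, snoc, untup_tup, walkCode_append]
  exact and_iff_right (tup_ne_zero _)

theorem CGen.wfTree (h : CGen c p false a) : WFTree (piOf a) := by
  suffices H : ∀ f : ℕ → ℕ, ∃ n, Shoen.walkCode a ((List.range n).map f) = 0 by
    rintro ⟨f, hf⟩
    obtain ⟨n, hn⟩ := H f
    have := (h.treeOf_iff.1 (hf n)).2
    rw [untup_tup] at this
    exact this hn
  have step : ∀ {a : ℕ}, (∀ i, Shoen.childCode a i = 0 ∨ ∀ f : ℕ → ℕ,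
      ∃ n, Shoen.walkCode (Shoen.childCode a i) ((List.range n).map f) = 0) →
      ∀ f : ℕ → ℕ, ∃ n, Shoen.walkCode a ((List.range n).map f) = 0 := by
    intro a ha f
    have hw : ∀ n, Shoen.walkCode a ((List.range (n + 1)).map f) =
        Shoen.walkCode (Shoen.childCode a (f 0)) ((List.range n).map (f ∘ Nat.succ)) := by
      intro n
      rw [List.range_succ_eq_map, List.map_cons, List.map_map]
      rfl
    rcases ha (f 0) with h0 | h1
    · exact ⟨1, by rw [hw, h0, walkCode_zero]⟩
    · obtain ⟨n, hn⟩ := h1 (f ∘ Nat.succ)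
      exact ⟨n + 1, by rw [hw, hn]⟩
  induction h with
  | ax => exact step fun i => Or.inl (childCode_ax _ _)
  | and Γ A B ha hb ea eb iha ihb =>
    refine step fun i => ?_
    rw [childCode_and]
    match i with
    | 0 => exact Or.inr iha
    | 1 => exact Or.inr ihb
    | _ + 2 => exact Or.inl rfl
  | or Γ A B ha ea iha =>
    refine step fun i => ?_
    rw [childCode_or]
    match i with
    | 0 => exact Or.inr iha
    | _ + 1 => exact Or.inl rfl
  | om Γ A hA hp htot hmem hend ih =>
    refine step fun i => ?_
    rw [childCode_om _ _ _ _ (htot i)]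
    exact Or.inr (ih i)
  | ex Γ A hA n ha ea iha =>
    refine step fun i => ?_
    rw [childCode_ex]
    match i with
    | 0 => exact Or.inr iha
    | _ + 1 => exact Or.inl rfl
  | cut hc Γ C ha hb ea eb iha ihb =>
    refine step fun i => ?_
    rw [childCode_cut]
    match i with
    | 0 => exact Or.inr iha
    | 1 => exact Or.inr ihb
    | _ + 2 => exact Or.inl rfl
  | omrep hr => simp at hr

theorem CGen.childCode_ne_zero_of_lt (h : CGen c p false a) {i j : ℕ} (hij : i < j)
    (hj : Shoen.childCode a j ≠ 0) : Shoen.childCode a i ≠ 0 := by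
  cases h with
  | ax => exact absurd (childCode_ax _ _) hj
  | and Γ A B ha hb =>
    rw [childCode_and] at hj ⊢
    match j with
    | 1 => obtain rfl : i = 0 := by omega
           exact ha.ne_zero
    | _ + 2 => exact absurd rfl hj
  | or Γ A B ha =>
    rw [childCode_or] at hj
    match j with
    | _ + 1 => exact absurd rfl hj
  | om Γ A hA hp htot hmem =>
    rw [childCode_om _ _ _ _ (htot i)]
    exact (hmem i).ne_zero
  | ex Γ A hA n ha =>
    rw [childCode_ex] at hj
    match j with
    | _ + 1 => exact absurd rfl hj
  | cut hc Γ C ha hb =>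
    rw [childCode_cut] at hj ⊢
    match j with
    | 1 => obtain rfl : i = 0 := by omega
           exact ha.ne_zero
    | _ + 2 => exact absurd rfl hj
  | omrep hr => simp at hr

theorem CGen.nodeVal_eq_ax (h : CGen c p false a) (h0 : Shoen.childCode a 0 = 0) :
    ∃ Γ : Finset Sentence, IsAxiom Γ ∧ nodeVal a = tup [axC, encS Γ] := by
  cases h with
  | ax Γ hΓ => exact ⟨Γ, hΓ, nodeVal_ax _⟩
  | and Γ A B ha =>
    rw [childCode_and] at h0
    exact absurd h0 ha.ne_zero
  | or Γ A B ha =>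
    rw [childCode_or] at h0
    exact absurd h0 ha.ne_zero
  | om Γ A hA hp htot hmem =>
    rw [childCode_om _ _ _ _ (htot 0)] at h0
    exact absurd h0 (hmem 0).ne_zero
  | ex Γ A hA n ha =>
    rw [childCode_ex] at h0
    exact absurd h0 ha.ne_zero
  | cut hc Γ C ha =>
    rw [childCode_cut] at h0
    exact absurd h0 ha.ne_zero
  | omrep hr => simp at hr

theorem CGen.correctInner (h : CGen c p false a) {π : ℕ → ℕ} {σ : ℕ}
    (hσ : π σ = nodeVal a)
    (htree : ∀ i, TreeOf π (snoc σ i) ↔ Shoen.childCode a i ≠ 0)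
    (hval : ∀ i, π (snoc σ i) = nodeVal (Shoen.childCode a i))
    (h0 : Shoen.childCode a 0 ≠ 0) : CorrectInner π σ := by
  unfold CorrectInner
  simp only [htree, hval, hσ]
  cases h with
  | ax => exact absurd (childCode_ax _ _) h0
  | and Γ A B ha hb ea eb =>
    refine Or.inl ⟨Γ, A, B, nodeVal_and _ _ _ _, ?_⟩
    simp only [childCode_and]
    exact ⟨ha.ne_zero, hb.ne_zero, not_not.2 rfl, ha.endS_nodeVal.trans ea,
      hb.endS_nodeVal.trans eb⟩
  | or Γ A B ha ea =>
    refine Or.inr (Or.inl ⟨Γ, A, B, nodeVal_or _ _ _, ?_⟩)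
    simp only [childCode_or]
    exact ⟨ha.ne_zero, not_not.2 rfl, ha.endS_nodeVal.trans ea⟩
  | om Γ A hA hp htot hmem hend =>
    refine Or.inr (Or.inr (Or.inl ⟨Γ, A, hA, nodeVal_om _ _ _, fun n => ?_, fun n => ?_⟩))
    · rw [childCode_om _ _ _ _ (htot n)]
      exact (hmem n).ne_zero
    · rw [childCode_om _ _ _ _ (htot n), (hmem n).endS_nodeVal, hend]
  | ex Γ A hA n ha ea =>
    refine Or.inr (Or.inr (Or.inr (Or.inl ⟨Γ, A, hA, n, nodeVal_ex _ _ _, ?_⟩)))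
    simp only [childCode_ex]
    exact ⟨ha.ne_zero, not_not.2 rfl, ha.endS_nodeVal.trans ea⟩
  | cut hc Γ C ha hb ea eb =>
    refine Or.inr (Or.inr (Or.inr (Or.inr ⟨Γ, C, nodeVal_cut _ _ _ _, ?_⟩)))
    simp only [childCode_cut]
    exact ⟨ha.ne_zero, hb.ne_zero, not_not.2 rfl, ha.endS_nodeVal.trans ea,
      hb.endS_nodeVal.trans eb⟩
  | omrep hr => simp at hr

theorem CGen.proj_nodeVal_ne_cutC (h : CGen false p false a) : proj (nodeVal a) 0 ≠ cutC := by
  cases h with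
  | ax => rw [nodeVal_ax]; simp [axC, cutC]
  | and => rw [nodeVal_and]; simp [andC, cutC]
  | or => rw [nodeVal_or]; simp [orC, cutC]
  | om => rw [nodeVal_om]; simp [omC, cutC]
  | ex => rw [nodeVal_ex]; simp [exC, cutC]
  | cut hc => simp at hc
  | omrep hr => simp at hr

theorem CGen.isOmegaProof (h : CGen c p false a) : IsOmegaProof (piOf a) where
  nonseq σ hσ := not_not.1 hσ
  downward σ τ hσ hτ hpre := by
    obtain ⟨l, hl⟩ := hpre
    refine h.treeOf_iff.2 ⟨hτ, fun h0 => (h.treeOf_iff.1 hσ).2 ?_⟩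
    rw [← hl, walkCode_append, h0, walkCode_zero]
  mono σ i j hij hj := by
    rw [h.treeOf_snoc_iff] at hj ⊢
    rcases h.walkCode (untup σ) with h0 | h1
    · simp [h0] at hj
    · exact h1.childCode_ne_zero_of_lt hij hj
  top σ hσ htop := by
    have hw := (h.walkCode (untup σ)).resolve_left (h.treeOf_iff.1 hσ).2
    rw [h.treeOf_snoc_iff, not_not] at htop
    rw [piOf, if_neg hσ.1]
    exact hw.nodeVal_eq_ax htop
  inner σ hσ hin :=
    ((h.walkCode (untup σ)).resolve_left (h.treeOf_iff.1 hσ).2).correctInner (if_neg hσ.1)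
      (fun _ => h.treeOf_snoc_iff) (piOf_snoc a σ) (h.treeOf_snoc_iff.1 hin)
  wf := h.wfTree

theorem CGen.cutFree (h : CGen false p false a) : CutFree (piOf a) := fun σ hσ => by
  rw [piOf, if_neg hσ.1]
  exact ((h.walkCode (untup σ)).resolve_left (h.treeOf_iff.1 hσ).2).proj_nodeVal_ne_cutC

end

/-! ### Closed instances of formulas with two free variables -/

/-- The environment sending variables `0` and `1` to `y` and `n`. -/
def pairEnv (n y : ℕ) : ℕ → ℕ := consEnv y (consEnv n fun _ => 0)

/-- The closed instance `t(n̄,ȳ)` of a term with free variables `0` and `1`. -/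
def Trm.inst (t : Trm) (n y : ℕ) : Trm := Trm.sub (numeral y) 0 (Trm.sub (numeral n) 1 t)

/-- The closed instance `A(n̄,ȳ)` of a formula with free variables `0` and `1`. -/
def Fml.inst (A : Fml) (n y : ℕ) : Fml := (A.sub (numeral n) 1).sub (numeral y) 0

theorem Fml.cu_sub_one {A : Fml} (h : A.cu 2 = true) (n : ℕ) :
    (A.sub (numeral n) 1).cu 1 = true :=
  A.cu_sub (numeral_cu n) h

/-- The sentence `A(n̄,ȳ)`. -/
def sInst₂ (A : Fml) (h : A.cu 2 = true) (n y : ℕ) : Sentence :=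
  sInst (A.sub (numeral n) 1) (Fml.cu_sub_one h n) y

theorem encF_sInst₂ (A : Fml) (h : A.cu 2 = true) (n y : ℕ) :
    encF (sInst₂ A h n y) = (A.inst n y).enc := rfl

theorem sub_numeral (t : Trm) (k n : ℕ) : Trm.sub t k (numeral n) = numeral n := by
  induction n with
  | zero => rfl
  | succ n ih => simp [numeral, Trm.sub, ih]

theorem val_numeral (ρ : ℕ → ℕ) (n : ℕ) : (numeral n).val ρ = n := by
  induction n with
  | zero => rfl
  | succ n ih => simp [numeral, Trm.val, ih]

theorem Trm.inst_var_zero (n y : ℕ) : (Trm.var 0).inst n y = numeral y := rfl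

theorem Trm.inst_var_one (n y : ℕ) : (Trm.var 1).inst n y = numeral n := by
  simp [Trm.inst, Trm.sub, sub_numeral]

theorem Trm.inst_var_add_two (i n y : ℕ) : (Trm.var (i + 2)).inst n y = .var i := by
  simp [Trm.inst, Trm.sub]

theorem Trm.val_inst (t : Trm) (n y : ℕ) :
    (t.inst n y).val (fun _ => 0) = t.val (pairEnv n y) := by
  induction t with
  | var i =>
    match i with
    | 0 => rw [inst_var_zero, val_numeral]; rfl
    | 1 => rw [inst_var_one, val_numeral]; rfl
    | i + 2 => rw [inst_var_add_two]; rfl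
  | zero => rfl
  | one => rfl
  | add s u ihs ihu => exact congrArg₂ (· + ·) ihs ihu
  | mul s u ihs ihu => exact congrArg₂ (· * ·) ihs ihu

theorem Fml.sat_inst {A : Fml} (hqf : A.qf = true) (n y : ℕ) :
    (A.inst n y).Sat (fun _ => 0) ↔ A.Sat (pairEnv n y) := by
  induction A with
  | eq s t =>
    change (s.inst n y).val _ = (t.inst n y).val _ ↔ _
    rw [Trm.val_inst, Trm.val_inst]; rfl
  | ne s t =>
    change (s.inst n y).val _ ≠ (t.inst n y).val _ ↔ _
    rw [Trm.val_inst, Trm.val_inst]; rfl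
  | and A B ihA ihB =>
    simp only [Fml.qf, Bool.and_eq_true] at hqf
    exact and_congr (ihA hqf.1) (ihB hqf.2)
  | or A B ihA ihB =>
    simp only [Fml.qf, Bool.and_eq_true] at hqf
    exact or_congr (ihA hqf.1) (ihB hqf.2)
  | all A => simp [Fml.qf] at hqf
  | ex A => simp [Fml.qf] at hqf

/-! ### Primitive recursiveness of Gödel numbers of instances -/

theorem primrec_enc_numeral : Primrec fun n => (numeral n).enc := by
  have hstep : Primrec₂ fun (_ : ℕ) (x : ℕ) => 5 * Nat.pair x 2 + 3 :=
    (Primrec.nat_add.comp (Primrec.nat_mul.comp (Primrec.const 5)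
      (Primrec₂.natPair.comp Primrec.snd (Primrec.const 2))) (Primrec.const 3)).to₂
  refine (Primrec.nat_rec₁ 1 hstep).of_eq fun n => ?_
  induction n with
  | zero => rfl
  | succ n ih => simp only [numeral, Trm.enc, ← ih]

section

variable {α : Type*} [Primcodable α] {f g : α → ℕ}

theorem primrec_mul_add (m r : ℕ) (hf : Primrec f) : Primrec fun x => m * f x + r :=
  Primrec.nat_add.comp (Primrec.nat_mul.comp (Primrec.const m) hf) (Primrec.const r)

theorem primrec_mul_pair_add (m r : ℕ) (hf : Primrec f) (hg : Primrec g) :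
    Primrec fun x => m * Nat.pair (f x) (g x) + r :=
  primrec_mul_add m r (Primrec₂.natPair.comp hf hg)

end

theorem Trm.primrec_enc_sub (t : Trm) (k : ℕ) :
    Primrec fun n => (Trm.sub (numeral n) k t).enc := by
  induction t with
  | var i =>
    simp only [Trm.sub]
    split_ifs
    exacts [primrec_enc_numeral, Primrec.const _, Primrec.const _]
  | zero => exact Primrec.const _
  | one => exact Primrec.const _
  | add s u ihs ihu => exact primrec_mul_pair_add 5 3 ihs ihu
  | mul s u ihs ihu => exact primrec_mul_pair_add 5 4 ihs ihu

theorem Fml.primrec_enc_sub (A : Fml) (k : ℕ) :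
    Primrec fun n => (A.sub (numeral n) k).enc := by
  induction A generalizing k with
  | eq s t => exact primrec_mul_pair_add 6 0 (s.primrec_enc_sub k) (t.primrec_enc_sub k)
  | ne s t => exact primrec_mul_pair_add 6 1 (s.primrec_enc_sub k) (t.primrec_enc_sub k)
  | and A B ihA ihB => exact primrec_mul_pair_add 6 2 (ihA k) (ihB k)
  | or A B ihA ihB => exact primrec_mul_pair_add 6 3 (ihA k) (ihB k)
  | all A ih => exact primrec_mul_add 6 4 (ih (k + 1))
  | ex A ih => exact primrec_mul_add 6 5 (ih (k + 1))

theorem Trm.primrec_enc_inst (t : Trm) : Primrec₂ fun n y => (t.inst n y).enc := by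
  induction t with
  | var i =>
    match i with
    | 0 => exact primrec_enc_numeral.comp Primrec.snd
    | 1 => exact (primrec_enc_numeral.comp Primrec.fst).of_eq fun q => by simp only [inst_var_one]
    | i + 2 =>
      exact (Primrec.const (5 * i)).of_eq fun q => by simp only [inst_var_add_two, Trm.enc]
  | zero => exact Primrec.const _
  | one => exact Primrec.const _
  | add s u ihs ihu => exact primrec_mul_pair_add 5 3 ihs ihu
  | mul s u ihs ihu => exact primrec_mul_pair_add 5 4 ihs ihu

theorem Fml.primrec_enc_inst {A : Fml} (hqf : A.qf = true) :
    Primrec₂ fun n y => (A.inst n y).enc := by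
  induction A with
  | eq s t => exact primrec_mul_pair_add 6 0 s.primrec_enc_inst t.primrec_enc_inst
  | ne s t => exact primrec_mul_pair_add 6 1 s.primrec_enc_inst t.primrec_enc_inst
  | and A B ihA ihB =>
    simp only [Fml.qf, Bool.and_eq_true] at hqf
    exact primrec_mul_pair_add 6 2 (ihA hqf.1) (ihB hqf.2)
  | or A B ihA ihB =>
    simp only [Fml.qf, Bool.and_eq_true] at hqf
    exact primrec_mul_pair_add 6 3 (ihA hqf.1) (ihB hqf.2)
  | all A => simp [Fml.qf] at hqf
  | ex A => simp [Fml.qf] at hqf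

theorem Trm.primrec_val (t : Trm) : Primrec₂ fun n y => t.val (pairEnv n y) := by
  induction t with
  | var i =>
    match i with
    | 0 => exact Primrec.snd
    | 1 => exact Primrec.fst
    | i + 2 => exact Primrec.const 0
  | zero => exact Primrec.const _
  | one => exact Primrec.const _
  | add s u ihs ihu => exact Primrec.nat_add.comp ihs ihu
  | mul s u ihs ihu => exact Primrec.nat_mul.comp ihs ihu

theorem Fml.primrecRel_sat {A : Fml} (hqf : A.qf = true) :
    PrimrecRel fun n y => A.Sat (pairEnv n y) := by
  induction A with
  | eq s t => exact Primrec.eq.comp s.primrec_val t.primrec_val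
  | ne s t => exact PrimrecPred.not (Primrec.eq.comp s.primrec_val t.primrec_val)
  | and A B ihA ihB =>
    simp only [Fml.qf, Bool.and_eq_true] at hqf
    exact PrimrecPred.and (ihA hqf.1) (ihB hqf.2)
  | or A B ihA ihB =>
    simp only [Fml.qf, Bool.and_eq_true] at hqf
    exact PrimrecPred.or (ihA hqf.1) (ihB hqf.2)
  | all A => simp [Fml.qf] at hqf
  | ex A => simp [Fml.qf] at hqf

/-! ### Finite proofs of true quantifier free sentences -/

open Classical in
/-- A local code of a finite cut free proof of `Γ ∪ {A(n̄,ȳ)}`, where `A(n̄,ȳ)` is a true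
quantifier free sentence and `l` lists the Gödel numbers of the members of `Γ`. -/
noncomputable def qfCode : Fml → ℕ → ℕ → List ℕ → ℕ
  | .and A B, n, y, l =>
    tup [andC, encode l, (Fml.inst (.and A B) n y).enc, qfCode A n y l, qfCode B n y l]
  | .or A B, n, y, l =>
    tup [orC, encode l, (Fml.inst (.or A B) n y).enc,
      if A.Sat (pairEnv n y) then qfCode A n y (sortedInsert (B.inst n y).enc l)
      else qfCode B n y (sortedInsert (A.inst n y).enc l)]
  | A, n, y, l => tup [axC, encode (sortedInsert (A.inst n y).enc l)]

theorem endS_ax (Γ : Finset Sentence) : EndS (tup [axC, encS Γ]) = Γ := by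
  simp [EndS]

theorem endS_main {R : ℕ} (hR : R ≠ cutC ∧ R ≠ axC ∧ R ≠ omrepC) (Γ : Finset Sentence)
    (A : Sentence) (l : List ℕ) : EndS (tup (R :: encS Γ :: encF A :: l)) = Γ ∪ {A} := by
  simp [EndS, hR]

theorem cgen_literal (p : Bool) {A : Fml} (hlit : A.isLiteral = true) (hqf : A.qf = true)
    (h2 : A.cu 2 = true) {n y : ℕ} (hsat : A.Sat (pairEnv n y)) {l : List ℕ}
    {Γ : Finset Sentence} (hl : Lists l Γ) :
    CGen false p false (tup [axC, encode (sortedInsert (A.inst n y).enc l)]) ∧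
      EndS (tup [axC, encode (sortedInsert (A.inst n y).enc l)]) = Γ ∪ {sInst₂ A h2 n y} := by
  rw [← encF_sInst₂ A h2, ← (hl.insert _).encS_eq]
  refine ⟨.ax _ ⟨sInst₂ A h2 n y, by simp, ?_, (A.sat_inst hqf n y).2 hsat⟩, endS_ax _⟩
  cases A <;> first | rfl | simp [Fml.isLiteral] at hlit

theorem qfCode_correct (p : Bool) {A : Fml} (hqf : A.qf = true) (h2 : A.cu 2 = true) {n y : ℕ}
    (hsat : A.Sat (pairEnv n y)) {l : List ℕ} {Γ : Finset Sentence} (hl : Lists l Γ) :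
    CGen false p false (qfCode A n y l) ∧ EndS (qfCode A n y l) = Γ ∪ {sInst₂ A h2 n y} := by
  induction A generalizing l Γ with
  | eq s t => exact cgen_literal p rfl hqf h2 hsat hl
  | ne s t => exact cgen_literal p rfl hqf h2 hsat hl
  | and A B ihA ihB =>
    have hqf' := hqf
    have h2' := h2
    simp only [Fml.qf, Fml.cu, Bool.and_eq_true] at hqf' h2'
    have hA := ihA hqf'.1 h2'.1 hsat.1 hl
    have hB := ihB hqf'.2 h2'.2 hsat.2 hl
    rw [qfCode, ← encF_sInst₂ _ h2, ← hl.encS_eq]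
    exact ⟨.and Γ (sInst₂ A h2'.1 n y) (sInst₂ B h2'.2 n y) hA.1 hB.1 hA.2 hB.2,
      endS_main (by decide) _ _ _⟩
  | or A B ihA ihB =>
    have hqf' := hqf
    have h2' := h2
    simp only [Fml.qf, Fml.cu, Bool.and_eq_true] at hqf' h2'
    rw [qfCode, ← encF_sInst₂ _ h2, ← hl.encS_eq]
    refine ⟨?_, endS_main (by decide) _ _ _⟩
    by_cases hA : A.Sat (pairEnv n y)
    · have h := ihA hqf'.1 h2'.1 hA (hl.insert (sInst₂ B h2'.2 n y))
      rw [if_pos hA]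
      refine .or Γ (sInst₂ A h2'.1 n y) (sInst₂ B h2'.2 n y) h.1 (h.2.trans ?_)
      rw [Finset.union_assoc, Finset.union_comm {_}]
      rfl
    · have h := ihB hqf'.2 h2'.2 (hsat.resolve_left hA) (hl.insert (sInst₂ A h2'.1 n y))
      rw [if_neg hA]
      refine .or Γ (sInst₂ A h2'.1 n y) (sInst₂ B h2'.2 n y) h.1 (h.2.trans ?_)
      rw [Finset.union_assoc]
      rfl
  | all A => simp [Fml.qf] at hqf
  | ex A => simp [Fml.qf] at hqf

section

variable {α : Type*} [Primcodable α] {f g h k m : α → ℕ}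

theorem primrec_tup_two (hf : Primrec f) (hg : Primrec g) : Primrec fun x => tup [f x, g x] :=
  primrec_tup.comp (Primrec.list_cons.comp hf (Primrec.list_cons.comp hg (Primrec.const [])))

theorem primrec_tup_three (hf : Primrec f) (hg : Primrec g) (hh : Primrec h) :
    Primrec fun x => tup [f x, g x, h x] :=
  primrec_tup.comp (Primrec.list_cons.comp hf (Primrec.list_cons.comp hg
    (Primrec.list_cons.comp hh (Primrec.const []))))

theorem primrec_tup_four (hf : Primrec f) (hg : Primrec g) (hh : Primrec h) (hk : Primrec k) :
    Primrec fun x => tup [f x, g x, h x, k x] :=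
  primrec_tup.comp (Primrec.list_cons.comp hf (Primrec.list_cons.comp hg
    (Primrec.list_cons.comp hh (Primrec.list_cons.comp hk (Primrec.const [])))))

theorem primrec_tup_five (hf : Primrec f) (hg : Primrec g) (hh : Primrec h) (hk : Primrec k)
    (hm : Primrec m) : Primrec fun x => tup [f x, g x, h x, k x, m x] :=
  primrec_tup.comp (Primrec.list_cons.comp hf (Primrec.list_cons.comp hg
    (Primrec.list_cons.comp hh (Primrec.list_cons.comp hk
      (Primrec.list_cons.comp hm (Primrec.const []))))))

end

theorem primrec_qfCode {A : Fml} (hqf : A.qf = true) :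
    Primrec fun q : (ℕ × ℕ) × List ℕ => qfCode A q.1.1 q.1.2 q.2 := by
  classical
  have henc : ∀ {B : Fml}, B.qf = true →
      Primrec fun q : (ℕ × ℕ) × List ℕ => (B.inst q.1.1 q.1.2).enc := fun hB =>
    (Fml.primrec_enc_inst hB).comp (Primrec.fst.comp Primrec.fst) (Primrec.snd.comp Primrec.fst)
  have hl : Primrec fun q : (ℕ × ℕ) × List ℕ => encode q.2 := Primrec.encode.comp Primrec.snd
  have hins : ∀ {B : Fml}, B.qf = true → Primrec fun q : (ℕ × ℕ) × List ℕ =>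
      sortedInsert (B.inst q.1.1 q.1.2).enc q.2 := fun hB =>
    primrec_sortedInsert.comp (henc hB) Primrec.snd
  induction A with
  | eq s t => exact primrec_tup_two (Primrec.const _) (Primrec.encode.comp (hins hqf))
  | ne s t => exact primrec_tup_two (Primrec.const _) (Primrec.encode.comp (hins hqf))
  | and A B ihA ihB =>
    have hqf' := hqf
    simp only [Fml.qf, Bool.and_eq_true] at hqf'
    exact primrec_tup_five (Primrec.const _) hl (henc hqf) (ihA hqf'.1) (ihB hqf'.2)
  | or A B ihA ihB =>
    have hqf' := hqf
    simp only [Fml.qf, Bool.and_eq_true] at hqf'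
    refine primrec_tup_four (Primrec.const _) hl (henc hqf) (Primrec.ite ?_ ?_ ?_)
    · exact PrimrecPred.comp (Fml.primrecRel_sat hqf'.1) Primrec.fst
    · exact (ihA hqf'.1).comp (Primrec.pair Primrec.fst (hins hqf'.2))
    · exact (ihB hqf'.2).comp (Primrec.pair Primrec.fst (hins hqf'.1))
  | all A => simp [Fml.qf] at hqf
  | ex A => simp [Fml.qf] at hqf

/-- No node below the code `b` is labelled by the `ω`-rule. -/
def OmegaFree (b : ℕ) : Prop := ∀ l, proj (walkCode b l) 0 ≠ omC

theorem omegaFree_zero : OmegaFree 0 := fun l => by simp [walkCode_zero, omC]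

theorem OmegaFree.childCode {b : ℕ} (h : OmegaFree b) (i : ℕ) : OmegaFree (childCode b i) :=
  fun l => h (i :: l)

theorem omegaFree_of_childCode {b : ℕ} (h0 : proj b 0 ≠ omC)
    (h : ∀ i, OmegaFree (childCode b i)) : OmegaFree b
  | [] => h0
  | i :: l => h i l

theorem omegaFree_getD {l : List ℕ} (h : ∀ a ∈ l, OmegaFree a) (i : ℕ) :
    OmegaFree (l.getD i 0) := by
  rw [List.getD_eq_getElem?_getD]
  rcases hi : l[i]? with _ | a
  · exact omegaFree_zero
  · exact h a (List.mem_of_getElem? hi)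

theorem omegaFree_qfCode (A : Fml) (n y : ℕ) (l : List ℕ) : OmegaFree (qfCode A n y l) := by
  have lit : ∀ g, OmegaFree (tup [axC, g]) := fun g =>
    omegaFree_of_childCode (by simp [axC, omC]) fun i => by
      rw [childCode_ax]; exact omegaFree_zero
  induction A generalizing l with
  | eq | ne | all | ex => exact lit _
  | and A B ihA ihB =>
    refine omegaFree_of_childCode (by simp [qfCode, andC, omC]) fun i => ?_
    rw [qfCode, childCode_and]
    exact omegaFree_getD (by simp [ihA, ihB]) i
  | or A B ihA ihB =>
    refine omegaFree_of_childCode (by simp [qfCode, orC, omC]) fun i => ?_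
    rw [qfCode, childCode_or]
    refine omegaFree_getD ?_ i
    simp only [List.mem_singleton, forall_eq]
    split_ifs
    exacts [ihA _, ihB _]

open Nat.Partrec (Code)

/-! ### The search proof of a true `Π₂` sentence

The node reached along a path `p` of `ω`-rule premises carries the sequent consisting of
`∀x∃y A(x,y)` and all `∃y A(n̄,y)` with `n ∈ p`.  As long as no `y < p.length` witnesses the first
entry of `p`, the `ω`-rule is applied once more to `∀x∃y A(x,y)`. -/

/-- The sentence `∀x∃y A(x,y)`. -/
def sAllEx (A : Fml) (h2 : A.cu 2 = true) : Sentence :=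
  sAll (.ex A) h2

/-- The sentence `∃y A(n̄,y)`. -/
def sExInst (A : Fml) (h2 : A.cu 2 = true) (n : ℕ) : Sentence :=
  sEx (A.sub (numeral n) 1) (Fml.cu_sub_one h2 n)

/-- The sequent at the node with path `p`. -/
def pathSeq (A : Fml) (h2 : A.cu 2 = true) : List ℕ → Finset Sentence
  | [] => {sAllEx A h2}
  | n :: p => pathSeq A h2 p ∪ {sExInst A h2 n}

/-- The increasing list of the Gödel numbers of the members of `pathSeq`. -/
def pathList (A : Fml) (p : List ℕ) : List ℕ :=
  p.foldr (fun n l => sortedInsert (Fml.ex (A.sub (numeral n) 1)).enc l) [(Fml.all (.ex A)).enc]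

open Classical in
/-- The least `y < p.length` witnessing `∃y A(n̄,y)` for the first entry `n` of `p`, or `p.length`
if there is none. -/
noncomputable def pathWitness (A : Fml) (p : List ℕ) : ℕ :=
  (List.range p.length).findIdx fun y => decide (A.Sat (pairEnv p.headI y))

/-- The local code of the search proof at the node with path `p`, where `c` computes the codes of
the children of a node from its path. -/
noncomputable def searchCode (A : Fml) (c : Code) (p : List ℕ) : ℕ :=
  if pathWitness A p < p.length then
    tup [exC, encode (pathList A p), (Fml.ex (A.sub (numeral p.headI) 1)).enc,
      qfCode A p.headI (pathWitness A p) (pathList A p)]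
  else
    tup [omC, encode (pathList A p), (Fml.all (.ex A)).enc, encode (c.curry (encode p))]

theorem lists_pathList (A : Fml) (h2 : A.cu 2 = true) (p : List ℕ) :
    Lists (pathList A p) (pathSeq A h2 p) := by
  induction p with
  | nil => exact lists_singleton (sAllEx A h2)
  | cons n p ih => exact ih.insert (sExInst A h2 n)

theorem mem_pathSeq {A : Fml} {h2 : A.cu 2 = true} {p : List ℕ} {B : Sentence} :
    B ∈ pathSeq A h2 p ↔ B = sAllEx A h2 ∨ ∃ n ∈ p, B = sExInst A h2 n := by
  induction p with
  | nil => simp [pathSeq]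
  | cons n p ih => simp [pathSeq, ih]; tauto

theorem pathSeq_concat (A : Fml) (h2 : A.cu 2 = true) (p : List ℕ) (n : ℕ) :
    pathSeq A h2 (p ++ [n]) = pathSeq A h2 p ∪ {sExInst A h2 n} := by
  ext B
  simp only [mem_pathSeq, List.mem_append, List.mem_singleton, Finset.mem_union,
    Finset.mem_singleton, or_and_right, exists_or, exists_eq_left, or_assoc]

theorem sat_pathWitness {A : Fml} {p : List ℕ} (h : pathWitness A p < p.length) :
    A.Sat (pairEnv p.headI (pathWitness A p)) := by
  classical
  have h' : pathWitness A p < (List.range p.length).length := by simpa using h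
  have : A.Sat (pairEnv p.headI (List.range p.length)[pathWitness A p]) :=
    of_decide_eq_true (List.findIdx_getElem (w := h'))
  rwa [List.getElem_range] at this

theorem length_le_of_le_pathWitness {A : Fml} {p : List ℕ} (h : p.length ≤ pathWitness A p)
    {y : ℕ} (hy : A.Sat (pairEnv p.headI y)) : p.length ≤ y := by
  classical
  by_contra! hlt
  refine absurd h (not_le.2 ?_)
  have := List.findIdx_lt_length_of_exists (xs := List.range p.length)
    (p := fun y => decide (A.Sat (pairEnv p.headI y))) ⟨y, by simpa using hlt, by simpa using hy⟩
  simpa [pathWitness] using this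

theorem primrec_enc_ex_sub (A : Fml) :
    Primrec fun n => (Fml.ex (A.sub (numeral n) 1)).enc :=
  primrec_mul_add 6 5 (A.primrec_enc_sub 1)

theorem primrec_pathList (A : Fml) : Primrec (pathList A) :=
  Primrec.list_foldr Primrec.id (Primrec.const _)
    (primrec_sortedInsert.comp ((primrec_enc_ex_sub A).comp (Primrec.fst.comp Primrec.snd))
      (Primrec.snd.comp Primrec.snd)).to₂

theorem primrec_pathWitness {A : Fml} (hqf : A.qf = true) : Primrec (pathWitness A) := by
  classical
  refine Primrec.list_findIdx (Primrec.list_range.comp Primrec.list_length) ?_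
  exact (PrimrecRel.decide (Fml.primrecRel_sat hqf)).comp
    (Primrec.list_headI.comp Primrec.fst) Primrec.snd

theorem primrec_searchCode {A : Fml} (hqf : A.qf = true) : Primrec₂ (searchCode A) := by
  have hw := (primrec_pathWitness hqf).comp (Primrec.snd (α := Code) (β := List ℕ))
  have hl := (primrec_pathList A).comp (Primrec.snd (α := Code) (β := List ℕ))
  have hn := Primrec.list_headI.comp (Primrec.snd (α := Code) (β := List ℕ))
  refine Primrec.ite (Primrec.nat_lt.comp hw (Primrec.list_length.comp Primrec.snd)) ?_ ?_
  · exact primrec_tup_four (Primrec.const _) (Primrec.encode.comp hl)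
      ((primrec_enc_ex_sub A).comp hn)
      ((primrec_qfCode hqf).comp (Primrec.pair (Primrec.pair hn hw) hl))
  · exact primrec_tup_four (Primrec.const _) (Primrec.encode.comp hl) (Primrec.const _)
      (Primrec.encode.comp (Nat.Partrec.Code.primrec₂_curry.comp Primrec.fst
        (Primrec.encode.comp Primrec.snd)))

/-- `c` computes the codes of the children of the nodes of the search proof. -/
def ComputesChildren (A : Fml) (c : Code) : Prop :=
  ∀ p n, peval (encode (c.curry (encode p))) n = Part.some (searchCode A c (p ++ [n]))

theorem exists_computesChildren {A : Fml} (hqf : A.qf = true) : ∃ c, ComputesChildren A c := by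
  have h : Primrec₂ fun (c : Code) (m : ℕ) =>
      searchCode A c (Denumerable.ofNat (List ℕ) m.unpair.1 ++ [m.unpair.2]) :=
    (primrec_searchCode hqf).comp Primrec.fst (Primrec.list_concat.comp
      ((Primrec.ofNat _).comp (Primrec.fst.comp (Primrec.unpair.comp Primrec.snd)))
      (Primrec.snd.comp (Primrec.unpair.comp Primrec.snd)))
  obtain ⟨c, hc⟩ := Nat.Partrec.Code.fixed_point₂ h.to_comp.partrec₂
  refine ⟨c, fun p n => ?_⟩
  rw [peval, Denumerable.ofNat_encode, Nat.Partrec.Code.eval_curry, hc]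
  simp

theorem ComputesChildren.primIndex {A : Fml} {c : Code} (hqf : A.qf = true)
    (hc : ComputesChildren A c) (p : List ℕ) : PrimIndex (encode (c.curry (encode p))) :=
  ⟨_, Primrec.nat_iff.1 ((primrec_searchCode hqf).comp (Primrec.const c)
    (Primrec.list_concat.comp (Primrec.const p) Primrec.id)), hc p⟩

theorem endS_searchCode (A : Fml) (h2 : A.cu 2 = true) (c : Code) (p : List ℕ) :
    EndS (searchCode A c p) = pathSeq A h2 p := by
  unfold searchCode
  rw [← (lists_pathList A h2 p).encS_eq]
  split_ifs with hw
  · refine (endS_main (by decide) _ (sExInst A h2 p.headI) _).trans ?_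
    rw [Finset.union_eq_left, Finset.singleton_subset_iff, mem_pathSeq]
    refine Or.inr ⟨_, ?_, rfl⟩
    cases p with
    | nil => simp at hw
    | cons n p => simp
  · refine (endS_main (by decide) _ (sAllEx A h2) _).trans ?_
    rw [Finset.union_eq_left, Finset.singleton_subset_iff, mem_pathSeq]
    exact Or.inl rfl

theorem cgen_searchCode_of_witness {A : Fml} (hqf : A.qf = true) (h2 : A.cu 2 = true) (c : Code)
    {p : List ℕ} (hw : pathWitness A p < p.length) : CprecM (searchCode A c p) := by
  have hl := lists_pathList A h2 p
  have hq := qfCode_correct true hqf h2 (sat_pathWitness hw) hl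
  rw [searchCode, if_pos hw, ← hl.encS_eq]
  exact .ex _ (A.sub (numeral p.headI) 1) (Fml.cu_sub_one h2 _) (pathWitness A p) hq.1 hq.2

theorem ComputesChildren.cgen_searchCode_of_children {A : Fml} {c : Code} (hqf : A.qf = true)
    (h2 : A.cu 2 = true) (hc : ComputesChildren A c) {p : List ℕ}
    (h : ∀ n, CprecM (searchCode A c (p ++ [n]))) : CprecM (searchCode A c p) := by
  by_cases hw : pathWitness A p < p.length
  · exact cgen_searchCode_of_witness hqf h2 c hw
  · rw [searchCode, if_neg hw, ← (lists_pathList A h2 p).encS_eq]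
    have hget : ∀ n (hd : (peval (encode (c.curry (encode p))) n).Dom),
        (peval (encode (c.curry (encode p))) n).get hd = searchCode A c (p ++ [n]) :=
      fun n hd => Part.get_eq_of_mem (by rw [hc p n]; exact Part.mem_some _) hd
    refine .om _ (.ex A) h2 (fun _ => hc.primIndex hqf p) (fun n => by rw [hc p n]; trivial)
      (fun n => ?_) (fun n => ?_)
    · rw [hget]; exact h n
    · rw [hget, endS_searchCode A h2, pathSeq_concat]; rfl

theorem ComputesChildren.cprecM {A : Fml} {c : Code} (hqf : A.qf = true) (h2 : A.cu 2 = true)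
    (hc : ComputesChildren A c) (htrue : ∀ n, ∃ y, A.Sat (pairEnv n y)) :
    CprecM (searchCode A c []) := by
  have key : ∀ n y, A.Sat (pairEnv n y) → ∀ d (q : List ℕ), y ≤ q.length + d →
      CprecM (searchCode A c (n :: q)) := by
    intro n y hy d
    induction d with
    | zero =>
      intro q hq
      refine cgen_searchCode_of_witness hqf h2 c (not_le.1 fun hle => ?_)
      have := length_le_of_le_pathWitness hle (y := y) hy
      simp at this
      omega
    | succ d ih =>
      intro q hq
      refine hc.cgen_searchCode_of_children hqf h2 fun m => ih (q ++ [m]) ?_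
      simp
      omega
  refine hc.cgen_searchCode_of_children hqf h2 fun n => ?_
  obtain ⟨y, hy⟩ := htrue n
  exact key n y hy y [] (by simp)

/-! ### The search proof is a primitive recursive function of its nodes -/

/-- Passage from a path and the code at its end to the child with number `n`. -/
noncomputable def searchStep (A : Fml) (c : Code) (s : List ℕ × ℕ) (n : ℕ) : List ℕ × ℕ :=
  (s.1 ++ [n],
    if proj s.2 0 = omC then searchCode A c (s.1 ++ [n])
    else if proj s.2 0 = andC ∨ proj s.2 0 = orC ∨ proj s.2 0 = exC ∨ proj s.2 0 = cutC then
      proj s.2 (n + 3)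
    else 0)

theorem primrec_searchStep {A : Fml} (hqf : A.qf = true) (c : Code) :
    Primrec₂ (searchStep A c) := by
  have hp : Primrec fun q : (List ℕ × ℕ) × ℕ => q.1.1 ++ [q.2] :=
    Primrec.list_concat.comp (Primrec.fst.comp Primrec.fst) Primrec.snd
  have hb : Primrec fun q : (List ℕ × ℕ) × ℕ => q.1.2 := Primrec.snd.comp Primrec.fst
  have hR : ∀ k, PrimrecPred fun q : (List ℕ × ℕ) × ℕ => proj q.1.2 0 = k := fun k =>
    Primrec.eq.comp (primrec_proj.comp hb (Primrec.const 0)) (Primrec.const k)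
  refine Primrec.pair hp (Primrec.ite (hR _) ?_ (Primrec.ite ?_ ?_ (Primrec.const 0)))
  · exact (primrec_searchCode hqf).comp (Primrec.const c) hp
  · exact (hR _).or ((hR _).or ((hR _).or (hR _)))
  · exact primrec_proj.comp hb (Primrec.nat_add.comp Primrec.snd (Primrec.const 3))

theorem ComputesChildren.searchCode_cases {A : Fml} {c : Code} (hc : ComputesChildren A c)
    (p : List ℕ) : OmegaFree (searchCode A c p) ∨ proj (searchCode A c p) 0 = omC ∧
      ∀ n, childCode (searchCode A c p) n = searchCode A c (p ++ [n]) := by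
  rw [searchCode]
  split_ifs with hw
  · refine Or.inl (omegaFree_of_childCode (by simp [exC, omC]) fun i => ?_)
    rw [childCode_ex]
    exact omegaFree_getD (by simp [omegaFree_qfCode]) i
  · refine Or.inr ⟨by simp, fun n => ?_⟩
    rw [childCode_om _ _ _ _ (by rw [hc p n]; trivial)]
    exact Part.get_eq_of_mem (by rw [hc p n]; exact Part.mem_some _) _

theorem ComputesChildren.foldl_searchStep {A : Fml} {c : Code} (hc : ComputesChildren A c)
    (l p : List ℕ) (b : ℕ) (hb : OmegaFree b ∨ b = searchCode A c p) :
    (l.foldl (searchStep A c) (p, b)).2 = walkCode b l := by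
  induction l generalizing p b with
  | nil => rfl
  | cons n l ih =>
    obtain ⟨hn, hchild⟩ : (OmegaFree (childCode b n) ∨ childCode b n = searchCode A c (p ++ [n])) ∧
        searchStep A c (p, b) n = (p ++ [n], childCode b n) := by
      have free : OmegaFree b → (OmegaFree (childCode b n) ∨
          childCode b n = searchCode A c (p ++ [n])) ∧
          searchStep A c (p, b) n = (p ++ [n], childCode b n) := fun h =>
        ⟨Or.inl (h.childCode n), by
          have h0 : proj b 0 ≠ omC := h []
          simp [searchStep, childCode, h0]⟩
      rcases hb with h | rfl
      · exact free h
      · rcases hc.searchCode_cases p with h | ⟨h0, h⟩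
        · exact free h
        · exact ⟨Or.inr (h n), by rw [h]; simp [searchStep, h0]⟩
    rw [List.foldl_cons, hchild, ih _ _ hn]
    rfl

theorem primrec_nodeVal : Primrec nodeVal := by
  have hp : ∀ k, Primrec fun b => proj b k := fun k =>
    primrec_proj.comp Primrec.id (Primrec.const k)
  have hR : ∀ k, PrimrecPred fun b => proj b 0 = k := fun k =>
    Primrec.eq.comp (hp 0) (Primrec.const k)
  refine Primrec.ite (hR _) ?_ (Primrec.ite ?_ ?_ (Primrec.const 0))
  · exact primrec_tup_two (Primrec.const _) (hp 1)
  · exact (hR _).or ((hR _).or ((hR _).or ((hR _).or (hR _))))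
  · exact primrec_tup_three (hp 0) (hp 1) (hp 2)

theorem ComputesChildren.primrec_piOf {A : Fml} {c : Code} (hqf : A.qf = true)
    (hc : ComputesChildren A c) : Nat.Primrec (piOf (searchCode A c [])) := by
  refine Primrec.nat_iff.1 (Primrec.ite (Primrec.eq.comp Primrec.id (Primrec.const 0))
    (Primrec.const 0) (primrec_nodeVal.comp ?_))
  have h : Primrec fun σ => ((untup σ).foldl (searchStep A c) ([], searchCode A c [])).2 :=
    Primrec.snd.comp (Primrec.list_foldl primrec_untup (Primrec.const _)
      ((primrec_searchStep hqf c).comp (Primrec.fst.comp Primrec.snd)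
        (Primrec.snd.comp Primrec.snd)).to₂)
  exact h.of_eq fun σ => hc.foldl_searchStep _ _ _ (Or.inr rfl)

/-- **The `Π₂` case of cut free primitive recursive completeness.**  Every
true `Π₂` sentence `∀x∃y A(x,y)` (with `A` quantifier free) has a primitive
recursive cut free `ω`-proof encodable in `C_prec^-`. -/
theorem pi2_cutfree_prim_completeness (A : Fml) (hqf : A.qf = true)
    (h2 : A.cu 2 = true)
    (htrue : sentTrue ⟨.all (.ex A), by simpa [Fml.cu] using h2⟩) :
    ∃ a : ℕ, CprecM a ∧
      EndS a = {(⟨.all (.ex A), by simpa [Fml.cu] using h2⟩ : Sentence)} ∧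
      Nat.Primrec (piOf a) ∧ IsOmegaProof (piOf a) ∧ CutFree (piOf a) := by
  obtain ⟨c, hc⟩ := exists_computesChildren hqf
  have h : CprecM (searchCode A c []) := hc.cprecM hqf h2 htrue
  exact ⟨_, h, endS_searchCode A h2 c [], hc.primrec_piOf hqf, h.isOmegaProof, h.cutFree⟩

end Shoen
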